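/- Under Assumption (A), if at some parameter vector η with all components positive the Tikhonov functional J_η has a unique minimizer over Q_ad, then for every i = 1, …, n the partial derivative ∂_iF(η) exists (∂_i⁻F(η) = ∂_i⁺F(η)), the one-sided maps h ↦ ∂_i⁻F(η + h e_i) and h ↦ ∂_i⁺F(η + h e_i) are continuous at h = 0, and F is differentiable at η. -/

import Mathlib

open Filter Set Topology

/-- The value function `F(η) = inf_{x ∈ Q} (φ(x) + Σ_i η_i ψ_i(x))` of
multi-parameter Tikhonov regularization. -/
noncomputable def valueFun {X : Type*} {n : ℕ} (Q : Set X) (φ : X → ℝ)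
    (ψ : Fin n → X → ℝ) (η : Fin n → ℝ) : ℝ :=
  sInf ((fun x => φ x + ∑ i, η i * ψ i x) '' Q)

/-- `HasDPlus F η i D` says that the right-sided partial derivative
`∂_i⁺F(η) = lim_{h→0⁺} (F(η + h eᵢ) - F(η))/h` exists and equals `D`. -/
def HasDPlus {n : ℕ} (F : (Fin n → ℝ) → ℝ) (η : Fin n → ℝ) (i : Fin n) (D : ℝ) : Prop :=
  Filter.Tendsto (fun h : ℝ => (F (η + h • (Pi.single i 1 : Fin n → ℝ)) - F η) / h)
    (nhdsWithin 0 (Set.Ioi 0)) (nhds D)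

/-- `HasDMinus F η i D` says that the left-sided partial derivative
`∂_i⁻F(η) = lim_{h→0⁺} (F(η) - F(η - h eᵢ))/h` exists and equals `D`. -/
def HasDMinus {n : ℕ} (F : (Fin n → ℝ) → ℝ) (η : Fin n → ℝ) (i : Fin n) (D : ℝ) : Prop :=
  Filter.Tendsto (fun h : ℝ => (F η - F (η - h • (Pi.single i 1 : Fin n → ℝ))) / h)
    (nhdsWithin 0 (Set.Ioi 0)) (nhds D)

/-- The set `M_η` of minimizers of the Tikhonov functional `J_η` over `Q`. -/
def minSet {X : Type*} {n : ℕ} (Q : Set X) (φ : X → ℝ) (ψ : Fin n → X → ℝ)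
    (η : Fin n → ℝ) : Set X :=
  {x | x ∈ Q ∧ ∀ z ∈ Q, φ x + ∑ i, η i * ψ i x ≤ φ z + ∑ i, η i * ψ i z}

/-- A sequence that eventually dominates each summand of a finite family up to any error, while
its total does not exceed that of the family in the limit, converges summand by summand. -/
theorem tendsto_of_eventually_lt_of_sum_le {ι : Type*} [Fintype ι] {a : ℕ → ι → ℝ} {b : ι → ℝ}
    (hlow : ∀ i, ∀ ε > 0, ∀ᶠ k in atTop, b i - ε < a k i)
    (hsum : ∀ ε > 0, ∀ᶠ k in atTop, ∑ i, a k i < ∑ i, b i + ε) (i : ι) :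
    Tendsto (fun k => a k i) atTop (𝓝 (b i)) := by
  classical
  rw [Metric.tendsto_atTop']
  suffices h : ∀ ε > 0, ∀ᶠ k in atTop, |a k i - b i| < ε by
    intro ε hε
    obtain ⟨N, hN⟩ := eventually_atTop.1 (h ε hε)
    exact ⟨N, fun k hk => hN k hk.le⟩
  intro ε hε
  set δ : ℝ := ε / (Fintype.card ι + 1) with hδ
  have hδ0 : 0 < δ := by positivity
  have hδε : (Fintype.card ι : ℝ) * δ + δ = ε := by
    rw [hδ]; field_simp
  have hall : ∀ᶠ k in atTop, ∀ j, b j - δ < a k j :=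
    eventually_all.2 fun j => hlow j δ hδ0
  filter_upwards [hall, hsum δ hδ0, hlow i ε hε] with k hk hs hi
  have h1 : a k i - (b i - δ) ≤ ∑ j, (a k j - (b j - δ)) :=
    Finset.single_le_sum (f := fun j => a k j - (b j - δ))
      (fun j _ => by linarith [hk j]) (Finset.mem_univ i)
  have h2 : ∑ j, (a k j - (b j - δ)) = ∑ j, a k j - (∑ j, b j - Fintype.card ι * δ) := by
    simp [Finset.sum_sub_distrib]
  rw [h2] at h1
  rw [abs_lt]
  constructor <;> linarith

/-- Under sequential compactness and lower semicontinuity, the penalties converge along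
minimizing families of the Tikhonov functional when the minimizer is unique. -/
theorem tendsto_penalty_of_unique_minimizer
    {X : Type*} [TopologicalSpace X] {n : ℕ} {Q : Set X}
    {φ : X → ℝ} (hφ : ∀ x, 0 ≤ φ x) {ψ : Fin n → X → ℝ} (hψ : ∀ i x, 0 ≤ ψ i x)
    (hcpt : ∀ u : ℕ → X, (∀ k, u k ∈ Q) →
      (∃ C : ℝ, ∀ k, φ (u k) ≤ C ∧ ∀ i, ψ i (u k) ≤ C) →
      ∃ xs ∈ Q, ∃ σ : ℕ → ℕ, StrictMono σ ∧ Tendsto (u ∘ σ) atTop (𝓝 xs))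
    (hlscφ : ∀ (u : ℕ → X) (x : X), (∀ k, u k ∈ Q) → x ∈ Q →
      Tendsto u atTop (𝓝 x) → φ x ≤ liminf (fun k => φ (u k)) atTop)
    (hlscψ : ∀ (i : Fin n) (u : ℕ → X) (x : X), (∀ k, u k ∈ Q) → x ∈ Q →
      Tendsto u atTop (𝓝 x) → ψ i x ≤ liminf (fun k => ψ i (u k)) atTop)
    {η : Fin n → ℝ} (hη : ∀ i, 0 < η i) {xη : X} (hxη : xη ∈ minSet Q φ ψ η)
    (huniq : ∀ x ∈ minSet Q φ ψ η, x = xη) (i : Fin n) :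
    Tendsto (fun x : Q => ψ i x)
      (comap (fun x : Q => φ x + ∑ j, η j * ψ j x) (𝓝 (φ xη + ∑ j, η j * ψ j xη)))
      (𝓝 (ψ i xη)) := by
  apply tendsto_of_subseq_tendsto
  intro u hu
  rw [tendsto_comap_iff] at hu
  obtain ⟨C, hC⟩ := hu.bddAbove_range
  have hC' : ∀ k, φ (u k) + ∑ j, η j * ψ j (u k) ≤ C := fun k => hC ⟨k, rfl⟩
  have hterm : ∀ j x, 0 ≤ η j * ψ j x := fun j x => mul_nonneg (hη j).le (hψ j x)
  have hφC : ∀ k, φ (u k) ≤ C := fun k => by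
    linarith [hC' k, Finset.sum_nonneg fun j (_ : j ∈ Finset.univ) => hterm j (u k)]
  have hC0 : 0 ≤ C := (hφ _).trans (hφC 0)
  have hψC : ∀ k j, ψ j (u k) ≤ C / η j := fun k j => by
    rw [le_div_iff₀ (hη j), mul_comm]
    linarith [hC' k, hφ (u k), Finset.single_le_sum (f := fun j => η j * ψ j (u k))
      (fun j _ => hterm j (u k)) (Finset.mem_univ j)]
  have hdiv : ∀ j, 0 ≤ C / η j := fun j => div_nonneg hC0 (hη j).le
  have hbdd : ∀ k, φ (u k) ≤ C + ∑ j, C / η j ∧ ∀ i, ψ i (u k) ≤ C + ∑ j, C / η j := by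
    intro k
    have hS := Finset.sum_nonneg fun j (_ : j ∈ Finset.univ) => hdiv j
    refine ⟨by linarith [hφC k], fun i => ?_⟩
    have hi := Finset.single_le_sum (f := fun j => C / η j) (fun j _ => hdiv j)
      (Finset.mem_univ i)
    linarith [hψC k i]
  obtain ⟨xs, hxs, σ, hσ, hlim⟩ := hcpt (fun k => u k) (fun k => (u k).2) ⟨_, hbdd⟩
  refine ⟨σ, ?_⟩
  have hlowφ : ∀ ε > 0, ∀ᶠ k in atTop, φ xs - ε < φ (u (σ k)) := fun ε hε => by
    refine eventually_lt_of_lt_liminf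
      (lt_of_lt_of_le (by linarith) (hlscφ _ xs (fun k => (u (σ k)).2) hxs hlim)) ?_
    exact isBoundedUnder_of ⟨0, fun k => hφ _⟩
  have hlowψ : ∀ j, ∀ ε > 0, ∀ᶠ k in atTop, ψ j xs - ε < ψ j (u (σ k)) := fun j ε hε => by
    refine eventually_lt_of_lt_liminf
      (lt_of_lt_of_le (by linarith) (hlscψ j _ xs (fun k => (u (σ k)).2) hxs hlim)) ?_
    exact isBoundedUnder_of ⟨0, fun k => hψ _ _⟩
  have hconv : ∀ ε > 0, ∀ᶠ k in atTop,
      φ (u (σ k)) + ∑ j, η j * ψ j (u (σ k)) < φ xη + ∑ j, η j * ψ j xη + ε := fun ε hε =>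
    (hu.comp hσ.tendsto_atTop).eventually_lt_const (by linarith)
  let a : ℕ → Option (Fin n) → ℝ :=
    fun k o => o.elim (φ (u (σ k))) fun j => η j * ψ j (u (σ k))
  let b : Option (Fin n) → ℝ := fun o => o.elim (φ xs) fun j => η j * ψ j xs
  have hlow : ∀ o, ∀ ε > 0, ∀ᶠ k in atTop, b o - ε < a k o := by
    rintro (_ | j) ε hε
    · exact hlowφ ε hε
    · filter_upwards [hlowψ j (ε / η j) (div_pos hε (hη j))] with k hk
      have := mul_lt_mul_of_pos_left hk (hη j)
      rw [mul_sub, mul_div_cancel₀ _ (hη j).ne'] at this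
      exact this
  have hsum : ∀ ε > 0, ∀ᶠ k in atTop, ∑ o, a k o < ∑ o, b o + ε := fun ε hε => by
    filter_upwards [hconv ε hε] with k hk
    simp only [a, b, Fintype.sum_option, Option.elim_none, Option.elim_some]
    linarith [hxη.2 xs hxs]
  have hlimit := tendsto_of_eventually_lt_of_sum_le hlow hsum
  have hxs_eq : xs = xη := by
    refine huniq xs ⟨hxs, fun z hz => ?_⟩
    have hJ : Tendsto (fun k => φ (u (σ k)) + ∑ j, η j * ψ j (u (σ k))) atTop
        (𝓝 (φ xs + ∑ j, η j * ψ j xs)) :=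
      (hlimit none).add (tendsto_finsetSum _ fun j _ => hlimit (some j))
    exact (tendsto_nhds_unique hJ (hu.comp hσ.tendsto_atTop)).le.trans (hxη.2 z hz)
  have h := (hlimit (some i)).const_mul (η i)⁻¹
  simpa [a, b, hxs_eq, (hη i).ne'] using h

/-- The value function is at most the Tikhonov functional at any admissible point. -/
theorem valueFun_le {X : Type*} {n : ℕ} {Q : Set X} {φ : X → ℝ} (hφ : ∀ x, 0 ≤ φ x)
    {ψ : Fin n → X → ℝ} (hψ : ∀ i x, 0 ≤ ψ i x) {ζ : Fin n → ℝ} (hζ : ∀ i, 0 ≤ ζ i)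
    {x : X} (hx : x ∈ Q) : valueFun Q φ ψ ζ ≤ φ x + ∑ i, ζ i * ψ i x := by
  refine csInf_le ⟨0, ?_⟩ ⟨x, hx, rfl⟩
  rintro _ ⟨z, -, rfl⟩
  exact add_nonneg (hφ z) (Finset.sum_nonneg fun i _ => mul_nonneg (hζ i) (hψ i z))

/-- If the penalties converge along minimizing families of the Tikhonov functional at `η`, then
they are close to their limit at all almost-minimizers for parameters near `η`. -/
theorem exists_eventually_penalty_close
    {X : Type*} {n : ℕ} {Q : Set X} {φ : X → ℝ} (hφ : ∀ x, 0 ≤ φ x)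
    {ψ : Fin n → X → ℝ} (hψ : ∀ i x, 0 ≤ ψ i x) {η : Fin n → ℝ} (hη : ∀ i, 0 < η i)
    {xη : X} (hxη : xη ∈ minSet Q φ ψ η)
    (hlim : ∀ i, Tendsto (fun x : Q => ψ i x)
      (comap (fun x : Q => φ x + ∑ j, η j * ψ j x) (𝓝 (φ xη + ∑ j, η j * ψ j xη)))
      (𝓝 (ψ i xη))) {ε : ℝ} (hε : 0 < ε) :
    ∃ r > 0, ∀ᶠ ζ in 𝓝 η, (∀ i, 0 ≤ ζ i) ∧
      ∀ x ∈ Q, φ x + ∑ i, ζ i * ψ i x < valueFun Q φ ψ ζ + r →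
        ∀ i, |ψ i x - ψ i xη| < ε := by
  set m := φ xη + ∑ j, η j * ψ j xη with hm
  have hclose : ∀ᶠ x : Q in comap (fun x : Q => φ x + ∑ j, η j * ψ j x) (𝓝 m),
      ∀ i, |ψ i x - ψ i xη| < ε :=
    eventually_all.2 fun i => (hlim i).eventually (Metric.ball_mem_nhds _ hε)
  obtain ⟨δ, hδ, hball⟩ := Metric.eventually_nhds_iff.1 (eventually_comap.1 hclose)
  have hbound : Tendsto (fun r : ℝ => ((1 + r) * m + r) / (1 - r)) (𝓝[>] 0) (𝓝 m) := by
    have h : ContinuousAt (fun r : ℝ => ((1 + r) * m + r) / (1 - r)) 0 :=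
      ContinuousAt.div (by fun_prop) (by fun_prop) (by norm_num)
    have h' := h.tendsto.mono_left (nhdsWithin_le_nhds (s := Ioi 0))
    simpa using h'
  obtain ⟨r, hr, hr1, hr0⟩ := ((hbound.eventually_lt_const (show m < m + δ by linarith)).and
    (((gt_mem_nhds one_pos).filter_mono nhdsWithin_le_nhds).and
      self_mem_nhdsWithin)).exists
  refine ⟨r, hr0, ?_⟩
  have hnear : ∀ᶠ ζ in 𝓝 η, ∀ i, (1 - r) * η i < ζ i ∧ ζ i < (1 + r) * η i :=
    eventually_all.2 fun i => by
      have hc : Tendsto (fun ζ : Fin n → ℝ => ζ i) (𝓝 η) (𝓝 (η i)) :=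
        (continuous_apply i).continuousAt
      have := mul_pos hr0 (hη i)
      exact (hc.eventually_const_lt (by linarith)).and (hc.eventually_lt_const (by linarith))
  filter_upwards [hnear] with ζ hζ
  have hζ0 : ∀ i, 0 ≤ ζ i := fun i =>
    (mul_nonneg (sub_nonneg.2 hr1.le) (hη i).le).trans (hζ i).1.le
  refine ⟨hζ0, fun x hx hxr => hball ?_ ⟨x, hx⟩ rfl⟩
  have hge := hxη.2 x hx
  have hup : ∑ i, ζ i * ψ i xη ≤ (1 + r) * ∑ i, η i * ψ i xη := by
    rw [Finset.mul_sum]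
    exact Finset.sum_le_sum fun i _ => by
      rw [← mul_assoc]; exact mul_le_mul_of_nonneg_right (hζ i).2.le (hψ i xη)
  have hdown : (1 - r) * ∑ i, η i * ψ i x ≤ ∑ i, ζ i * ψ i x := by
    rw [Finset.mul_sum]
    exact Finset.sum_le_sum fun i _ => by
      rw [← mul_assoc]; exact mul_le_mul_of_nonneg_right (hζ i).1.le (hψ i x)
  have hF := valueFun_le hφ hψ hζ0 hxη.1
  have hJ : φ x + ∑ i, η i * ψ i x ≤ ((1 + r) * m + r) / (1 - r) := by
    rw [le_div_iff₀ (sub_pos.2 hr1)]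
    have h1 := mul_nonneg hr0.le (hφ x)
    have h2 := mul_nonneg hr0.le (hφ xη)
    rw [hm]
    linarith
  rw [Real.dist_eq, abs_lt]
  constructor <;> linarith

/-- The value function is strictly differentiable wherever the penalties converge along
minimizing families. -/
theorem hasStrictFDerivAt_valueFun
    {X : Type*} {n : ℕ} {Q : Set X} {φ : X → ℝ} (hφ : ∀ x, 0 ≤ φ x)
    {ψ : Fin n → X → ℝ} (hψ : ∀ i x, 0 ≤ ψ i x) {η : Fin n → ℝ} (hη : ∀ i, 0 < η i)
    {xη : X} (hxη : xη ∈ minSet Q φ ψ η)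
    (hlim : ∀ i, Tendsto (fun x : Q => ψ i x)
      (comap (fun x : Q => φ x + ∑ j, η j * ψ j x) (𝓝 (φ xη + ∑ j, η j * ψ j xη)))
      (𝓝 (ψ i xη))) :
    HasStrictFDerivAt (valueFun Q φ ψ)
      (∑ i, ψ i xη • (ContinuousLinearMap.proj i : (Fin n → ℝ) →L[ℝ] ℝ)) η := by
  set L := ∑ i, ψ i xη • (ContinuousLinearMap.proj i : (Fin n → ℝ) →L[ℝ] ℝ) with hL
  have hLv : ∀ v, L v = ∑ i, v i * ψ i xη := fun v => by
    simp [hL, mul_comm]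
  refine .of_isLittleO (Asymptotics.isLittleO_iff.2 fun c hc => ?_)
  set ε : ℝ := c / (n + 1) with hεdef
  have hε : 0 < ε := by positivity
  have hnε : n * ε ≤ c := by
    have : n * ε + ε = c := by rw [hεdef]; field_simp
    linarith
  obtain ⟨r, hr, hnear⟩ := exists_eventually_penalty_close hφ hψ hη hxη hlim hε
  have hone : ∀ ζ ζ' : Fin n → ℝ, (∀ i, 0 ≤ ζ' i) →
      (∀ x ∈ Q, φ x + ∑ i, ζ i * ψ i x < valueFun Q φ ψ ζ + r →
        ∀ i, |ψ i x - ψ i xη| < ε) →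
      valueFun Q φ ψ ζ' - valueFun Q φ ψ ζ - L (ζ' - ζ) ≤ c * ‖ζ' - ζ‖ := by
    intro ζ ζ' hζ' h
    refine le_of_forall_pos_le_add fun s hs => ?_
    obtain ⟨_, ⟨x, hx, rfl⟩, hxlt⟩ := exists_lt_of_csInf_lt (Set.Nonempty.image _ ⟨xη, hxη.1⟩)
      (show valueFun Q φ ψ ζ < valueFun Q φ ψ ζ + min s r from
        lt_add_of_pos_right _ (lt_min hs hr))
    have hcl := h x hx (hxlt.trans_le (by gcongr; exact min_le_right _ _))
    have hle := valueFun_le hφ hψ hζ' hx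
    have hdiff : ∑ i, (ζ' - ζ) i * (ψ i x - ψ i xη) ≤ c * ‖ζ' - ζ‖ := by
      calc ∑ i, (ζ' - ζ) i * (ψ i x - ψ i xη)
          ≤ ∑ _i : Fin n, ‖ζ' - ζ‖ * ε := Finset.sum_le_sum fun i _ => by
            refine (le_abs_self _).trans ?_
            rw [abs_mul]
            exact mul_le_mul (norm_le_pi_norm (ζ' - ζ) i) (hcl i).le (abs_nonneg _)
              (norm_nonneg _)
        _ = n * ε * ‖ζ' - ζ‖ := by simp; ring
        _ ≤ c * ‖ζ' - ζ‖ := by gcongr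
    have hexp : ∑ i, (ζ' - ζ) i * (ψ i x - ψ i xη)
        = ∑ i, ζ' i * ψ i x - ∑ i, ζ i * ψ i x - L (ζ' - ζ) := by
      rw [hLv, ← Finset.sum_sub_distrib, ← Finset.sum_sub_distrib]
      exact Finset.sum_congr rfl fun i _ => by simp only [Pi.sub_apply]; ring
    have hmin := min_le_left s r
    dsimp only at hxlt
    linarith
  rw [nhds_prod_eq]
  filter_upwards [hnear.prod_mk hnear] with p hp
  have h1 := hone p.2 p.1 hp.1.1 hp.2.2
  have h2 := hone p.1 p.2 hp.2.1 hp.1.2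
  rw [norm_sub_rev, ← neg_sub p.1 p.2, map_neg] at h2
  rw [Real.norm_eq_abs, abs_le]
  constructor <;> linarith

/-- Difference quotients inherit the error bound of a strict derivative. -/
theorem abs_div_sub_le_of_norm_sub_le {E : Type*} [NormedAddCommGroup E] [NormedSpace ℝ E]
    {F : E → ℝ} {L : E →L[ℝ] ℝ} {c h : ℝ} {x y e : E} (he : ‖e‖ = 1) (hh : 0 < h)
    (hxy : x - y = h • e) (hF : ‖F x - F y - L (x - y)‖ ≤ c * ‖x - y‖) :
    |(F x - F y) / h - L e| ≤ c := by
  rw [hxy, map_smul, norm_smul, he, mul_one, Real.norm_eq_abs, Real.norm_eq_abs,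
    abs_of_pos hh, smul_eq_mul] at hF
  have : (F x - F y) / h - L e = (F x - F y - h * L e) / h := by field_simp
  rwa [this, abs_div, abs_of_pos hh, div_le_iff₀ hh]

/-- At a point of strict differentiability both one-sided partial derivatives exist. -/
theorem HasStrictFDerivAt.hasDMinus_hasDPlus {n : ℕ} {F : (Fin n → ℝ) → ℝ}
    {L : (Fin n → ℝ) →L[ℝ] ℝ} {η : Fin n → ℝ} (hF : HasStrictFDerivAt F L η) (i : Fin n) :
    HasDMinus F η i (L (Pi.single i 1)) ∧ HasDPlus F η i (L (Pi.single i 1)) := by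
  have he : ‖(Pi.single i 1 : Fin n → ℝ)‖ = 1 := by
    rw [Pi.norm_single (G := fun _ : Fin n => ℝ), norm_one]
  have key : ∀ a b : ℝ → Fin n → ℝ, Continuous a → Continuous b → a 0 = η → b 0 = η →
      (∀ h, a h - b h = h • (Pi.single i 1 : Fin n → ℝ)) →
      Tendsto (fun h => (F (a h) - F (b h)) / h) (𝓝[>] 0) (𝓝 (L (Pi.single i 1))) := by
    intro a b ha hb ha0 hb0 hab
    rw [Metric.tendsto_nhds]
    intro ε hε
    have hev := Asymptotics.isLittleO_iff.1 hF.isLittleO (half_pos hε)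
    have hcont : Tendsto (fun h => (a h, b h)) (𝓝[>] 0) (𝓝 (η, η)) := by
      have := (ha.prodMk hb).tendsto 0
      rw [ha0, hb0] at this
      exact this.mono_left nhdsWithin_le_nhds
    filter_upwards [hcont.eventually hev, self_mem_nhdsWithin] with h hh h0
    exact (abs_div_sub_le_of_norm_sub_le he h0 (hab h) hh).trans_lt (half_lt_self hε)
  exact ⟨key (fun _ => η) (fun h => η - h • Pi.single i 1) (by fun_prop) (by fun_prop)
      rfl (by simp) (fun _ => sub_sub_cancel _ _),
    key (fun h => η + h • Pi.single i 1) (fun _ => η) (by fun_prop) (by fun_prop)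
      (by simp) rfl (fun _ => add_sub_cancel_left _ _)⟩

/-- Near a point of strict differentiability, one-sided partial derivatives are close to the
partial derivative at that point. -/
theorem HasStrictFDerivAt.eventually_abs_sub_le {n : ℕ} {F : (Fin n → ℝ) → ℝ}
    {L : (Fin n → ℝ) →L[ℝ] ℝ} {η : Fin n → ℝ} (hF : HasStrictFDerivAt F L η) (i : Fin n)
    {c : ℝ} (hc : 0 < c) :
    ∀ᶠ ζ in 𝓝 η, ∀ D, HasDMinus F ζ i D ∨ HasDPlus F ζ i D →
      |D - L (Pi.single i 1)| ≤ c := by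
  have he : ‖(Pi.single i 1 : Fin n → ℝ)‖ = 1 := by
    rw [Pi.norm_single (G := fun _ : Fin n => ℝ), norm_one]
  have hev := eventually_eventually_nhds.2 (Asymptotics.isLittleO_iff.1 hF.isLittleO hc)
  have hdiag : Tendsto (fun ζ : Fin n → ℝ => (ζ, ζ)) (𝓝 η) (𝓝 (η, η)) :=
    (continuous_id.prodMk continuous_id).tendsto η
  filter_upwards [hdiag.eventually hev] with ζ hζ D hD
  have key : ∀ a b : ℝ → Fin n → ℝ, Continuous a → Continuous b → a 0 = ζ → b 0 = ζ →
      (∀ h, a h - b h = h • (Pi.single i 1 : Fin n → ℝ)) →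
      Tendsto (fun h => (F (a h) - F (b h)) / h) (𝓝[>] 0) (𝓝 D) →
      |D - L (Pi.single i 1)| ≤ c := by
    intro a b ha hb ha0 hb0 hab hlim
    refine le_of_tendsto (hlim.sub_const _).abs ?_
    have hcont : Tendsto (fun h => (a h, b h)) (𝓝[>] 0) (𝓝 (ζ, ζ)) := by
      have := (ha.prodMk hb).tendsto 0
      rw [ha0, hb0] at this
      exact this.mono_left nhdsWithin_le_nhds
    filter_upwards [hcont.eventually hζ, self_mem_nhdsWithin] with h hh h0
    exact abs_div_sub_le_of_norm_sub_le he h0 (hab h) hh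
  rcases hD with hD | hD
  · exact key (fun _ => ζ) (fun h => ζ - h • Pi.single i 1) (by fun_prop) (by fun_prop)
      rfl (by simp) (fun _ => sub_sub_cancel _ _) hD
  · exact key (fun h => ζ + h • Pi.single i 1) (fun _ => ζ) (by fun_prop) (by fun_prop)
      (by simp) rfl (fun _ => add_sub_cancel_left _ _) hD

/-- One-sided partial derivatives along a coordinate line are continuous at a point of strict
differentiability. -/
theorem HasStrictFDerivAt.continuousAt_oneSided {n : ℕ} {F : (Fin n → ℝ) → ℝ}
    {L : (Fin n → ℝ) →L[ℝ] ℝ} {η : Fin n → ℝ} (hF : HasStrictFDerivAt F L η) (i : Fin n)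
    {g : ℝ → ℝ} (hg : ∀ᶠ h in 𝓝 (0 : ℝ),
      HasDMinus F (η + h • (Pi.single i 1 : Fin n → ℝ)) i (g h) ∨
        HasDPlus F (η + h • (Pi.single i 1 : Fin n → ℝ)) i (g h)) :
    ContinuousAt g 0 := by
  have hline : Tendsto (fun h : ℝ => η + h • (Pi.single i 1 : Fin n → ℝ)) (𝓝 0) (𝓝 η) := by
    have : Continuous fun h : ℝ => η + h • (Pi.single i 1 : Fin n → ℝ) := by fun_prop
    simpa using this.tendsto 0
  have hlim : Tendsto g (𝓝 0) (𝓝 (L (Pi.single i 1))) := by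
    rw [Metric.tendsto_nhds]
    intro ε hε
    filter_upwards [hline.eventually (hF.eventually_abs_sub_le i (half_pos hε)), hg]
      with h hh hgh
    exact (hh _ hgh).trans_lt (half_lt_self hε)
  exact continuousAt_of_tendsto_nhds hlim

/-- under Assumption (A), if `J_η` has a unique minimizer over `Q` at a
positive `η`, then all partial derivatives `∂_iF(η)` exist, the one-sided maps
`h ↦ ∂_i^∓F(η + h eᵢ)` are continuous at `h = 0`, and `F` is differentiable at `η`. -/
theorem differentiability_at_unique_minimizer
    {X : Type*} [TopologicalSpace X] {n : ℕ} (Q : Set X) (hQ : Q.Nonempty)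
    (φ : X → ℝ) (hφ : ∀ x, 0 ≤ φ x)
    (ψ : Fin n → X → ℝ) (hψ : ∀ i x, 0 ≤ ψ i x)
    -- Assumption (A)(i): sequential compactness
    (hcpt : ∀ u : ℕ → X, (∀ k, u k ∈ Q) →
      (∃ C : ℝ, ∀ k, φ (u k) ≤ C ∧ ∀ i, ψ i (u k) ≤ C) →
      ∃ xs ∈ Q, ∃ σ : ℕ → ℕ, StrictMono σ ∧
        Filter.Tendsto (u ∘ σ) Filter.atTop (nhds xs))
    -- Assumption (A)(ii): sequential lower semicontinuity
    (hlscφ : ∀ (u : ℕ → X) (x : X), (∀ k, u k ∈ Q) → x ∈ Q →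
      Filter.Tendsto u Filter.atTop (nhds x) →
      φ x ≤ Filter.liminf (fun k => φ (u k)) Filter.atTop)
    (hlscψ : ∀ (i : Fin n) (u : ℕ → X) (x : X), (∀ k, u k ∈ Q) → x ∈ Q →
      Filter.Tendsto u Filter.atTop (nhds x) →
      ψ i x ≤ Filter.liminf (fun k => ψ i (u k)) Filter.atTop)
    (η : Fin n → ℝ) (hη : ∀ i, 0 < η i)
    -- the Tikhonov functional has a unique minimizer at η
    (xη : X) (hxη : xη ∈ minSet Q φ ψ η)
    (huniq : ∀ x ∈ minSet Q φ ψ η, x = xη) :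
    (∀ i : Fin n, ∃ D : ℝ,
      HasDMinus (valueFun Q φ ψ) η i D ∧ HasDPlus (valueFun Q φ ψ) η i D) ∧
    (∀ i : Fin n, ∀ gm : ℝ → ℝ,
      (∀ h : ℝ, 0 < η i + h →
        HasDMinus (valueFun Q φ ψ) (η + h • (Pi.single i 1 : Fin n → ℝ)) i (gm h)) →
      ContinuousAt gm 0) ∧
    (∀ i : Fin n, ∀ gp : ℝ → ℝ,
      (∀ h : ℝ, 0 < η i + h →
        HasDPlus (valueFun Q φ ψ) (η + h • (Pi.single i 1 : Fin n → ℝ)) i (gp h)) →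
      ContinuousAt gp 0) ∧
    DifferentiableAt ℝ (valueFun Q φ ψ) η := by
  have hF := hasStrictFDerivAt_valueFun hφ hψ hη hxη
    (tendsto_penalty_of_unique_minimizer hφ hψ hcpt hlscφ hlscψ hη hxη huniq)
  have hpos : ∀ i, ∀ᶠ h in 𝓝 (0 : ℝ), 0 < η i + h := fun i =>
    (continuous_const.add continuous_id).tendsto' 0 (η i) (by simp) |>.eventually_const_lt (hη i)
  exact ⟨fun i => ⟨_, hF.hasDMinus_hasDPlus i⟩,
    fun i _ hg => hF.continuousAt_oneSided i ((hpos i).mono fun h hh => Or.inl (hg h hh)),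
    fun i _ hg => hF.continuousAt_oneSided i ((hpos i).mono fun h hh => Or.inr (hg h hh)),
    hF.hasFDerivAt.differentiableAt⟩
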